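/- Let μ be a complex number and n ≥ 1 an integer. Then b_{2n+1}(0,1,μ) · (n+2)_{n+1} · (μ/2+n)_{n+1} = 2 · (μ/2+2n)_{n+1} · (μ+2n−1)_{n+1} · b_{2n}(0,1,μ). (Equivalently, when the denominators are nonzero, b_{2n+1}(0,1)/b_{2n}(0,1) = 2 (μ/2+2n)_{n+1} (μ+2n−1)_{n+1} / ( (n+2)_{n+1} (μ/2+n)_{n+1} ).) -/

import Mathlib

/-- Generalized binomial coefficient `C(x,k) = x(x-1)⋯(x-k+1)/k!` for complex `x`. -/
noncomputable def gbinom (x : ℂ) (k : ℕ) : ℂ :=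
  (∏ i ∈ Finset.range k, (x - i)) / (k.factorial : ℂ)

/-- Pochhammer symbol `(x)_k = x(x+1)⋯(x+k-1)`. -/
noncomputable def poch (x : ℂ) (k : ℕ) : ℂ :=
  ∏ i ∈ Finset.range k, (x + i)
/-- `b_n(I,J,μ)`: determinant of the `n×n` matrix with rows indexed by
`i = I,…,n-1+I`, columns indexed by `j = J,…,n-1+J`, and entries
`-δ_{i,j} + C(μ+i+j-2, j)`. -/
noncomputable def bdet (μ : ℂ) (n I J : ℕ) : ℂ :=
  Matrix.det (Matrix.of fun i j : Fin n =>
    (if I + i.1 = J + j.1 then (-1 : ℂ) else 0)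
      + gbinom (μ + ((I + i.1 : ℕ) : ℂ) + ((J + j.1 : ℕ) : ℂ) - 2) (J + j.1))

section Operator

variable {K R : Type*} [CommRing K] [CommRing R] [Algebra K R]

/-- Lowest-order symbol of `symOp` on `X ^ k` : the indicial polynomial at the origin. -/
def indicial (n m k : R) : R := k * (k - 2 * n - 1) * (k + 2 * n + m - 1)

/-- The second coefficient of `symOp` on powers of `X * (1 - X)`. -/
def nextSymbol (n m k : R) : R := (k - n) * (2 * k + m - 1) * (2 * k + 2 * n + m)

/-- The third-order Fuchsian operator, written through the Euler derivation `D = X d/dX`,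
which is symmetric under the permutations of its singular points `0, 1, ∞`. -/
def symOp (D : Derivation K R R) (X n m f : R) : R :=
  (1 - X) ^ 2 * (D (D (D f)) - 3 * D (D f) + 2 * D f)
    + (m + 1) * (1 - X) * (1 - 2 * X) * (D (D f) - D f)
    + (m - 1 - (2 * n + 1) * (2 * n + m - 1)
        + (-2 * m + 2 * n * (m - 1) + 2 * n * (2 * n + m) - (m - 1) * (2 * n + m))
          * X * (1 - X)) * D f
    + n * (m - 1) * (2 * n + m) * X * (1 - 2 * X) * f

lemma symOp_sub (D : Derivation K R R) (X n m f g : R) :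
    symOp D X n m (f - g) = symOp D X n m f - symOp D X n m g := by
  simp only [symOp, map_sub]; ring

lemma symOp_sum_const_mul (D : Derivation K R R) (X n m : R) (s : Finset ℕ) (c y : ℕ → R)
    (hc : ∀ k, D (c k) = 0) :
    symOp D X n m (∑ k ∈ s, c k * y k) = ∑ k ∈ s, c k * symOp D X n m (y k) := by
  have h : ∀ z : ℕ → R, D (∑ k ∈ s, c k * z k) = ∑ k ∈ s, c k * D (z k) := by
    intro z
    simp [map_sum, Derivation.leibniz, hc]
  simp only [symOp, h, Finset.mul_sum, ← Finset.sum_sub_distrib, ← Finset.sum_add_distrib]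
  exact Finset.sum_congr rfl fun k _ => by ring

/-- Action of `symOp` on a solution of a first-order equation `(1 - X) D y = p y`. -/
lemma symOp_of_first_order (D : Derivation K R R) {X : R} (n m : R) {p p' p'' y : R}
    (hX : D X = X) (hp : D p = p') (hp' : D p' = p'') (hy : (1 - X) * D y = p * y) :
    (1 - X) * symOp D X n m y =
      ((1 - X) * (-X * p' + (1 - X) * p'' + X * p + X * p' + 2 * p * p')
        + ((1 - X) * p' + X * p + p ^ 2) * (p + 2 * X)
        - 3 * (1 - X) * ((1 - X) * p' + X * p + p ^ 2) + 2 * (1 - X) ^ 2 * p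
        + (m + 1) * (1 - 2 * X) * ((1 - X) * p' + X * p + p ^ 2 - (1 - X) * p)
        + (m - 1 - (2 * n + 1) * (2 * n + m - 1)
            + (-2 * m + 2 * n * (m - 1) + 2 * n * (2 * n + m) - (m - 1) * (2 * n + m))
              * X * (1 - X)) * p
        + n * (m - 1) * (2 * n + m) * X * (1 - 2 * X) * (1 - X)) * y := by
  have h2 : (1 - X) ^ 2 * D (D y) = ((1 - X) * p' + X * p + p ^ 2) * y := by
    have h := congrArg D hy
    simp only [Derivation.leibniz, map_sub, Derivation.map_one_eq_zero, hX, hp, smul_eq_mul] at h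
    linear_combination (1 - X) * h + (X + p) * hy
  have h3 : (1 - X) ^ 3 * D (D (D y)) =
      ((1 - X) * (-X * p' + (1 - X) * p'' + X * p + X * p' + 2 * p * p')
        + ((1 - X) * p' + X * p + p ^ 2) * (p + 2 * X)) * y := by
    have h := congrArg D h2
    simp only [Derivation.leibniz, map_sub, map_add, Derivation.map_one_eq_zero, hX, hp, hp',
      smul_eq_mul, pow_two] at h
    linear_combination (1 - X) * h + ((1 - X) * p' + X * p + p ^ 2) * hy + 2 * X * h2
  rw [symOp]
  linear_combination h3 - 3 * (1 - X) * h2 + 2 * (1 - X) ^ 2 * hy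
    + (m + 1) * (1 - 2 * X) * (h2 - (1 - X) * hy)
    + (m - 1 - (2 * n + 1) * (2 * n + m - 1)
            + (-2 * m + 2 * n * (m - 1) + 2 * n * (2 * n + m) - (m - 1) * (2 * n + m))
              * X * (1 - X)) * hy

lemma symOp_symmetric_power (D : Derivation K R R) {X k : R} (n m : R) {y : R}
    (hX : D X = X) (hk : D k = 0) (hy : (1 - X) * D y = k * (1 - 2 * X) * y) :
    (1 - X) * symOp D X n m y =
      (1 - 2 * X) * (indicial n m k - X * (1 - X) * nextSymbol n m k) * y := by
  have h2 : D (2 : R) = 0 := by exact_mod_cast D.map_natCast 2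
  rw [symOp_of_first_order D n m (p := k * (1 - 2 * X)) (p' := -2 * k * X) (p'' := -2 * k * X)
    hX (by simp [Derivation.leibniz, hX, hk, h2]; ring)
    (by simp [Derivation.leibniz, hX, hk, h2]) hy, indicial, nextSymbol]
  ring

lemma symOp_rotated_power (D : Derivation K R R) {X k m : R} (n : R) {y : R}
    (hX : D X = X) (hk : D k = 0) (hm : D m = 0)
    (hy : (1 - X) * D y = (k + (m - 1 + k) * X) * y) :
    (1 - X) * symOp D X n m y =
      (1 + X) * (indicial n m k * (1 - X) ^ 2 + X * nextSymbol n m k) * y := by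
  rw [symOp_of_first_order D n m (p := k + (m - 1 + k) * X) (p' := (m - 1 + k) * X)
    (p'' := (m - 1 + k) * X)
    hX (by simp [Derivation.leibniz, hX, hk, hm])
    (by simp [Derivation.leibniz, hX, hk, hm]) hy, indicial, nextSymbol]
  ring

lemma symOp_pow_mul (D : Derivation K R R) {X h₁ h₂ h₃ : R} (n m h : R) (j : ℕ)
    (hX : D X = X) (hu : D h = X * h₁) (hu' : D (D h) = X * h₂) (hu'' : D (D (D h)) = X * h₃) :
    ∃ w, symOp D X n m (X ^ j * h) = X ^ j * (indicial n m (j : R) * h + X * w) := by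
  have hpow : ∀ z, D (X ^ j * z) = X ^ j * (j * z + D z) := by
    intro z
    rcases j with _ | j
    · simp
    · simp only [Derivation.leibniz, Derivation.leibniz_pow, hX, smul_eq_mul, nsmul_eq_mul,
        Nat.add_sub_cancel]
      ring
  have hj : ∀ z, D ((j : R) * z) = j * D z := by
    intro z
    simp [Derivation.leibniz]
  let b := m + 1
  let c₁ := -2 * m + 2 * n * (m - 1) + 2 * n * (2 * n + m) - (m - 1) * (2 * n + m)
  let e := n * (m - 1) * (2 * n + m)
  let i : R := j
  refine ⟨(-2 * (i ^ 3 - 3 * i ^ 2 + 2 * i) - 3 * b * (i ^ 2 - i) + c₁ * i + e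
      + X * ((i ^ 3 - 3 * i ^ 2 + 2 * i) + 2 * b * (i ^ 2 - i) - c₁ * i - 2 * e)) * h
    + ((1 - X) ^ 2 * (3 * i ^ 2 - 6 * i + 2) + b * (1 - X) * (1 - 2 * X) * (2 * i - 1)
        + (m - 1 - (2 * n + 1) * (2 * n + m - 1) + c₁ * X * (1 - X))) * h₁
    + ((1 - X) ^ 2 * (3 * i - 3) + b * (1 - X) * (1 - 2 * X)) * h₂ + (1 - X) ^ 2 * h₃, ?_⟩
  simp only [symOp, hpow, map_add, hj, indicial, b, c₁, e, i]
  rw [hu'', hu', hu]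
  ring

lemma telescope_symbol (n m z : R) (c : ℕ → R) (N : ℕ)
    (hc : ∀ k < N, c (k + 1) * indicial n m ((k : R) + 1) = c k * nextSymbol n m (k : R)) :
    ∑ k ∈ Finset.range (N + 1),
      c k * ((indicial n m (k : R) - z * nextSymbol n m (k : R)) * z ^ k)
      = - (c N * nextSymbol n m (N : R) * z ^ (N + 1)) := by
  induction N with
  | zero => simp [indicial]; ring
  | succ N ih =>
    rw [Finset.sum_range_succ, ih fun k hk => hc k (by omega)]
    have := hc N (by omega)
    push_cast
    linear_combination z ^ (N + 1) * this

end Operator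

section BinomialSeries

lemma gbinom_zero (x : ℂ) : gbinom x 0 = 1 := by simp [gbinom]

lemma succ_mul_gbinom_succ (x : ℂ) (k : ℕ) :
    ((k : ℂ) + 1) * gbinom x (k + 1) = (x - k) * gbinom x k := by
  have h : (k.factorial : ℂ) ≠ 0 := by exact_mod_cast k.factorial_ne_zero
  have h' : (k : ℂ) + 1 ≠ 0 := by exact_mod_cast k.succ_ne_zero
  rw [gbinom, gbinom, Finset.prod_range_succ, Nat.factorial_succ]
  push_cast
  field_simp

lemma succ_mul_gbinom_succ_succ (x : ℂ) (k : ℕ) :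
    ((k : ℂ) + 1) * gbinom (x + 1) (k + 1) = (x + 1) * gbinom x k := by
  have h : (k.factorial : ℂ) ≠ 0 := by exact_mod_cast k.factorial_ne_zero
  have h' : (k : ℂ) + 1 ≠ 0 := by exact_mod_cast k.succ_ne_zero
  have hp : ∏ i ∈ Finset.range k, (x + 1 - ((i + 1 : ℕ) : ℂ)) = ∏ i ∈ Finset.range k, (x - i) :=
    Finset.prod_congr rfl fun i _ => by push_cast; ring
  rw [gbinom, gbinom, Finset.prod_range_succ', hp, Nat.factorial_succ]
  push_cast
  field_simp
  ring

lemma gbinom_pascal (x : ℂ) (k : ℕ) :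
    gbinom (x + 1) (k + 1) = gbinom x (k + 1) + gbinom x k := by
  have h' : (k : ℂ) + 1 ≠ 0 := by exact_mod_cast k.succ_ne_zero
  apply mul_left_cancel₀ h'
  linear_combination succ_mul_gbinom_succ_succ x k - succ_mul_gbinom_succ x k

open PowerSeries

/-- The Euler derivation `X d/dX` on power series. -/
noncomputable def eulerD : Derivation ℂ ℂ⟦X⟧ ℂ⟦X⟧ :=
  (X : ℂ⟦X⟧) • d⁄dX ℂ

lemma eulerD_apply (f : ℂ⟦X⟧) : eulerD f = X * d⁄dX ℂ f := rfl

lemma eulerD_X : eulerD X = X := by simp [eulerD_apply]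

lemma eulerD_C (c : ℂ) : eulerD (C c) = 0 := by simp [eulerD_apply]

lemma coeff_eulerD (f : ℂ⟦X⟧) (k : ℕ) : coeff k (eulerD f) = k * coeff k f := by
  rcases k with _ | k
  · simp [eulerD_apply]
  · rw [eulerD_apply, coeff_succ_X_mul, coeff_derivative]
    push_cast
    ring

/-- The expansion of `(1 - X) ^ (1 - m - i)`. -/
noncomputable def rowSeries (m : ℂ) (i : ℕ) : ℂ⟦X⟧ :=
  PowerSeries.mk fun j => gbinom (m + i + j - 2) j

lemma constantCoeff_rowSeries (m : ℂ) (i : ℕ) : constantCoeff (rowSeries m i) = 1 := by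
  rw [← coeff_zero_eq_constantCoeff_apply, rowSeries, coeff_mk, gbinom_zero]

lemma rowSeries_eq_mul_succ (m : ℂ) (i : ℕ) :
    rowSeries m i = (1 - X) * rowSeries m (i + 1) := by
  ext k
  rcases k with _ | k
  · simp [rowSeries, sub_mul, gbinom_zero]
  · have h := gbinom_pascal (m + i + k - 1) k
    rw [sub_mul, one_mul, map_sub, coeff_succ_X_mul, rowSeries, rowSeries, coeff_mk, coeff_mk,
      coeff_mk]
    push_cast
    rw [show m + (i + 1) + (k + 1) - 2 = m + i + k - 1 + 1 by ring,
      show m + i + (k + 1) - 2 = m + i + k - 1 by ring,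
      show m + (i + 1) + k - 2 = m + i + k - 1 by ring]
    linear_combination -h

lemma eulerD_rowSeries (m : ℂ) (i : ℕ) :
    (1 - X) * eulerD (rowSeries m i) = (C m - 1 + (i : ℂ⟦X⟧)) * X * rowSeries m i := by
  have hc : (C m - 1 + i : ℂ⟦X⟧) = C (m - 1 + i) := by simp
  rw [hc]
  ext k
  rcases k with _ | k
  · simp [sub_mul, mul_assoc, eulerD_apply]
  · have h := succ_mul_gbinom_succ_succ (m + i + k - 2) k
    rw [sub_mul, one_mul, map_sub, coeff_succ_X_mul, mul_assoc, coeff_C_mul, coeff_succ_X_mul,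
      coeff_eulerD, coeff_eulerD, rowSeries, coeff_mk, coeff_mk]
    push_cast
    rw [show m + i + (k + 1) - 2 = m + i + k - 2 + 1 by ring]
    linear_combination h

/-- The geometric series, the image of `X` under the order three substitution. -/
noncomputable def geomSeries : ℂ⟦X⟧ := PowerSeries.mk 1

lemma one_sub_mul_geomSeries : (1 - X) * geomSeries = 1 := by
  rw [mul_comm]; exact mk_one_mul_one_sub_eq_one ℂ

lemma rowSeries_eq (m : ℂ) (i : ℕ) : rowSeries m i = rowSeries m 0 * geomSeries ^ i := by
  induction i with
  | zero => simp
  | succ i ih =>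
    rw [pow_succ, ← mul_assoc, ← ih, rowSeries_eq_mul_succ m i]
    linear_combination (-rowSeries m (i + 1)) * one_sub_mul_geomSeries

lemma one_sub_X_ne_zero : (1 - X : ℂ⟦X⟧) ≠ 0 := fun h => by
  simpa [h] using one_sub_mul_geomSeries

lemma geomSeries_symmetric : geomSeries * (1 - geomSeries) = -X * geomSeries ^ 2 := by
  linear_combination (-geomSeries) * one_sub_mul_geomSeries

lemma rotated_power_eq (m : ℂ) (k : ℕ) :
    rowSeries m 0 * (geomSeries * (1 - geomSeries)) ^ k = (-X) ^ k * rowSeries m (2 * k) := by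
  rw [rowSeries_eq m (2 * k), geomSeries_symmetric, mul_pow, ← pow_mul]
  ring

lemma indicial_C (n j : ℕ) (m : ℂ) :
    indicial (n : ℂ⟦X⟧) (C m) (j : ℂ⟦X⟧) = C (indicial (n : ℂ) m j) := by
  simp [indicial, map_ofNat (C (R := ℂ)) 2]

lemma nextSymbol_C (n j : ℕ) (m : ℂ) :
    nextSymbol (n : ℂ⟦X⟧) (C m) (j : ℂ⟦X⟧) = C (nextSymbol (n : ℂ) m j) := by
  simp [nextSymbol, map_ofNat (C (R := ℂ)) 2]

lemma indicial_ne_zero {n j : ℕ} {m : ℂ} (hm : m.im ≠ 0) (hj : 0 < j) (hj' : j ≤ 2 * n) :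
    indicial (n : ℂ) m j ≠ 0 := by
  refine mul_ne_zero (mul_ne_zero (by exact_mod_cast hj.ne') ?_) ?_
  · intro h
    have : (j : ℂ) = (2 * n + 1 : ℕ) := by push_cast; linear_combination h
    have := Nat.cast_injective this
    omega
  · intro h
    have := congrArg Complex.im h
    simp [hm] at this

lemma X_pow_dvd_of_symOp_eq_zero {n : ℕ} {m : ℂ} (hm : m.im ≠ 0) {g : ℂ⟦X⟧}
    (hg : symOp eulerD X (n : ℂ⟦X⟧) (C m) g = 0) (h0 : constantCoeff g = 0) :
    ∀ j ≤ 2 * n, X ^ (j + 1) ∣ g := by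
  intro j
  induction j with
  | zero => intro _; simpa using X_dvd_iff.2 h0
  | succ j ih =>
    intro hj
    obtain ⟨h, rfl⟩ := ih (by omega)
    obtain ⟨w, hw⟩ := symOp_pow_mul eulerD (n : ℂ⟦X⟧) (C m) h (j + 1) eulerD_X
      (eulerD_apply _) (eulerD_apply _) (eulerD_apply _)
    rw [hw, indicial_C] at hg
    have h2 := (mul_eq_zero.1 hg).resolve_left (pow_ne_zero _ X_ne_zero)
    have h3 := congrArg constantCoeff h2
    simp only [map_add, map_mul, constantCoeff_C, constantCoeff_X, zero_mul, add_zero,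
      map_zero] at h3
    have h4 := (mul_eq_zero.1 h3).resolve_left (indicial_ne_zero hm (by omega) hj)
    rw [pow_succ X (j + 1)]
    exact mul_dvd_mul_left _ (X_dvd_iff.2 h4)

lemma symOp_sum_eq_zero {n : ℕ} {m : ℂ} {c : ℕ → ℂ} {y z v : ℂ⟦X⟧}
    (hc : ∀ k < n, c (k + 1) * indicial (n : ℂ) m ((k : ℂ) + 1) = c k * nextSymbol (n : ℂ) m k)
    (hy : ∀ k : ℕ, (1 - X) * symOp eulerD X (n : ℂ⟦X⟧) (C m) (y * z ^ k) =
      v * (indicial (n : ℂ⟦X⟧) (C m) k - z * nextSymbol (n : ℂ⟦X⟧) (C m) k) * (y * z ^ k)) :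
    symOp eulerD X (n : ℂ⟦X⟧) (C m) (∑ k ∈ Finset.range (n + 1), C (c k) * (y * z ^ k)) = 0 := by
  apply (mul_eq_zero.1 _).resolve_left one_sub_X_ne_zero
  rw [symOp_sum_const_mul _ _ _ _ _ _ _ fun k => eulerD_C _, Finset.mul_sum]
  have ht := telescope_symbol (n : ℂ⟦X⟧) (C m) z (fun k => C (c k)) n fun k hk => by
    have := congrArg (C (R := ℂ)) (hc k hk)
    rw [map_mul, map_mul, ← nextSymbol_C] at this
    rw [← this, ← Nat.cast_succ, ← Nat.cast_succ, indicial_C]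
  have hz : nextSymbol (n : ℂ⟦X⟧) (C m) n = 0 := by simp [nextSymbol]
  rw [hz, mul_zero, zero_mul, neg_zero] at ht
  calc _ = v * y * ∑ k ∈ Finset.range (n + 1), C (c k) *
        ((indicial (n : ℂ⟦X⟧) (C m) k - z * nextSymbol (n : ℂ⟦X⟧) (C m) k) * z ^ k) := by
        rw [Finset.mul_sum]
        refine Finset.sum_congr rfl fun k _ => ?_
        linear_combination C (c k) * hy k
    _ = 0 := by rw [ht, mul_zero]

lemma symOp_sum_symmetric_eq_zero {n : ℕ} {m : ℂ} {c : ℕ → ℂ}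
    (hc : ∀ k < n, c (k + 1) * indicial (n : ℂ) m ((k : ℂ) + 1) = c k * nextSymbol (n : ℂ) m k) :
    symOp eulerD X (n : ℂ⟦X⟧) (C m)
      (∑ k ∈ Finset.range (n + 1), C (c k) * (1 * (X * (1 - X)) ^ k)) = 0 := by
  refine symOp_sum_eq_zero (v := 1 - 2 * X) hc fun k => ?_
  refine symOp_symmetric_power _ _ _ eulerD_X (by simp) ?_
  rcases k with _ | k
  · simp
  · simp only [Derivation.leibniz, Derivation.leibniz_pow, eulerD_X, map_sub,
      Derivation.map_one_eq_zero, smul_eq_mul, nsmul_eq_mul, Nat.add_sub_cancel]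
    ring

lemma symOp_sum_rotated_eq_zero {n : ℕ} {m : ℂ} {c : ℕ → ℂ}
    (hc : ∀ k < n, c (k + 1) * indicial (n : ℂ) m ((k : ℂ) + 1) = c k * nextSymbol (n : ℂ) m k) :
    symOp eulerD X (n : ℂ⟦X⟧) (C m) (∑ k ∈ Finset.range (n + 1),
      C (c k) * (rowSeries m 0 * (geomSeries * (1 - geomSeries)) ^ k)) = 0 := by
  refine symOp_sum_eq_zero (v := (1 + X) * (1 - X) ^ 2) hc fun k => ?_
  rw [symOp_rotated_power eulerD (n : ℂ⟦X⟧) (k := (k : ℂ⟦X⟧)) eulerD_X (by simp) (eulerD_C m),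
    geomSeries_symmetric]
  · linear_combination (-(1 + X) * X * nextSymbol (n : ℂ⟦X⟧) (C m) k
      * (rowSeries m 0 * (-X * geomSeries ^ 2) ^ k)) * (1 + (1 - X) * geomSeries)
        * one_sub_mul_geomSeries
  · rw [rotated_power_eq]
    have h := eulerD_rowSeries m (2 * k)
    have hp : eulerD ((-X : ℂ⟦X⟧) ^ k) = (k : ℂ⟦X⟧) * (-X) ^ k := by
      rcases k with _ | k
      · simp
      · simp only [Derivation.leibniz_pow, eulerD_X, map_neg, smul_eq_mul, nsmul_eq_mul,
          Nat.add_sub_cancel]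
        ring
    rw [Derivation.leibniz, hp, smul_eq_mul, smul_eq_mul]
    push_cast at h
    linear_combination (-X) ^ k * h

/-- Rotating a symmetric solution changes it only beyond degree `2 n`. -/
lemma coeff_rotated_eq {n : ℕ} {m : ℂ} {c : ℕ → ℂ} (hm : m.im ≠ 0)
    (hc : ∀ k < n, c (k + 1) * indicial (n : ℂ) m ((k : ℂ) + 1) = c k * nextSymbol (n : ℂ) m k)
    {j : ℕ} (hj : j ≤ 2 * n) :
    coeff j (∑ k ∈ Finset.range (n + 1),
      C (c k) * (rowSeries m 0 * (geomSeries * (1 - geomSeries)) ^ k))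
    = coeff j (∑ k ∈ Finset.range (n + 1), C (c k) * (1 * (X * (1 - X)) ^ k) : ℂ⟦X⟧) := by
  have hs := symOp_sub eulerD X (n : ℂ⟦X⟧) (C m)
    (∑ k ∈ Finset.range (n + 1), C (c k) * (rowSeries m 0 * (geomSeries * (1 - geomSeries)) ^ k))
    (∑ k ∈ Finset.range (n + 1), C (c k) * (1 * (X * (1 - X)) ^ k))
  rw [symOp_sum_rotated_eq_zero hc, symOp_sum_symmetric_eq_zero hc, sub_zero] at hs
  have h := X_pow_dvd_iff.1 (X_pow_dvd_of_symOp_eq_zero hm hs ?_ j hj) j (by omega)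
  · rw [map_sub] at h
    exact sub_eq_zero.1 h
  · rw [map_sub, map_sum, map_sum, sub_eq_zero]
    refine Finset.sum_congr rfl fun k _ => ?_
    rw [geomSeries_symmetric]
    simp [constantCoeff_rowSeries]

end BinomialSeries

section Determinant

lemma last_mul_det_of_vecMul_eq_single {N : ℕ} (A : Matrix (Fin (N + 1)) (Fin (N + 1)) ℂ)
    (v : Fin (N + 1) → ℂ) (q : ℂ) (h : Matrix.vecMul v A = Pi.single (Fin.last N) q) :
    v (Fin.last N) * A.det = q * (A.submatrix Fin.castSucc Fin.castSucc).det := by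
  have h1 := congrFun (congrArg (fun w => Matrix.vecMul w A.adjugate) h) (Fin.last N)
  simp only [Matrix.vecMul_vecMul, Matrix.mul_adjugate, Matrix.vecMul_smul, Matrix.vecMul_one,
    Matrix.single_vecMul, Pi.smul_apply, smul_eq_mul, Matrix.row_apply] at h1
  rw [Matrix.adjugate_fin_succ_eq_det_submatrix] at h1
  simp only [Fin.succAbove_last, ← two_mul, pow_mul, neg_one_sq, one_pow, one_mul] at h1
  rw [mul_comm, h1]

open PowerSeries

/-- The polynomial `∑ c k * (X * (1 - X)) ^ k`, whose coefficients annihilate all but the last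
column. -/
noncomputable def symPoly (c : ℕ → ℂ) (n : ℕ) : Polynomial ℂ :=
  ∑ k ∈ Finset.range (n + 1),
    Polynomial.C (c k) * (Polynomial.X * (1 - Polynomial.X)) ^ k

lemma natDegree_sym_pow_le (k : ℕ) :
    ((Polynomial.X * (1 - Polynomial.X) : Polynomial ℂ) ^ k).natDegree ≤ k * 2 := by
  refine Polynomial.natDegree_pow_le_of_le k ?_
  compute_degree

lemma natDegree_symPoly_le (c : ℕ → ℂ) (n : ℕ) : (symPoly c n).natDegree ≤ 2 * n := by
  refine Polynomial.natDegree_sum_le_of_forall_le _ _ fun k hk => ?_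
  refine (Polynomial.natDegree_C_mul_le _ _).trans ((natDegree_sym_pow_le k).trans ?_)
  have := Finset.mem_range.1 hk
  omega

lemma coeff_symPoly (c : ℕ → ℂ) (n : ℕ) : (symPoly c n).coeff (2 * n) = (-1) ^ n * c n := by
  rw [symPoly, Polynomial.finsetSum_coeff, Finset.sum_range_succ, Finset.sum_eq_zero, zero_add,
    Polynomial.coeff_C_mul, mul_comm 2 n, Polynomial.coeff_pow_of_natDegree_le, mul_comm]
  · congr 2
    rw [Polynomial.coeff_X_mul, Polynomial.coeff_sub, Polynomial.coeff_X_one,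
      Polynomial.coeff_one]
    norm_num
  · compute_degree
  · intro k hk
    rw [Polynomial.coeff_C_mul, Polynomial.coeff_eq_zero_of_natDegree_lt, mul_zero]
    have := Finset.mem_range.1 hk
    have := natDegree_sym_pow_le k
    omega

lemma coe_symPoly (c : ℕ → ℂ) (n : ℕ) :
    (symPoly c n : ℂ⟦X⟧) = ∑ k ∈ Finset.range (n + 1), C (c k) * (1 * (X * (1 - X)) ^ k) := by
  have h : (symPoly c n : ℂ⟦X⟧) = Polynomial.coeToPowerSeries.ringHom (symPoly c n) := rfl
  rw [h, symPoly, map_sum]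
  simp

lemma sum_coeff_symPoly_rowSeries (c : ℕ → ℂ) (n : ℕ) (m : ℂ) :
    ∑ i ∈ Finset.range (2 * n + 1), C ((symPoly c n).coeff i) * rowSeries m i
      = ∑ k ∈ Finset.range (n + 1),
        C (c k) * (rowSeries m 0 * (geomSeries * (1 - geomSeries)) ^ k) := by
  have h := Polynomial.aeval_eq_sum_range' (p := symPoly c n) (n := 2 * n + 1)
    (by have := natDegree_symPoly_le c n; omega) geomSeries
  calc _ = rowSeries m 0 * Polynomial.aeval geomSeries (symPoly c n) := by
        rw [h, Finset.mul_sum]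
        refine Finset.sum_congr rfl fun i _ => ?_
        rw [rowSeries_eq m i, PowerSeries.smul_eq_C_mul]
        ring
    _ = _ := by
        rw [symPoly, map_sum, Finset.mul_sum]
        refine Finset.sum_congr rfl fun k _ => ?_
        simp only [map_mul, map_pow, map_sub, map_one, Polynomial.aeval_X, Polynomial.aeval_C]
        rw [show algebraMap ℂ ℂ⟦X⟧ (c k) = C (c k) from rfl]
        ring

lemma coeff_rotated_last (c : ℕ → ℂ) (n : ℕ) (m : ℂ) :
    coeff (2 * n + 1) (∑ k ∈ Finset.range (n + 1),
        C (c k) * (rowSeries m 0 * (geomSeries * (1 - geomSeries)) ^ k))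
      = ∑ k ∈ Finset.range (n + 1),
        c k * ((-1) ^ k * gbinom (m + 2 * n - 1 + k) (2 * n + 1 - k)) := by
  rw [map_sum]
  refine Finset.sum_congr rfl fun k hk => ?_
  have hk' : k ≤ 2 * n + 1 := by have := Finset.mem_range.1 hk; omega
  have hC : (-X : ℂ⟦X⟧) ^ k = C ((-1) ^ k) * X ^ k := by
    rw [neg_pow]; simp
  rw [coeff_C_mul, rotated_power_eq, hC, mul_assoc, coeff_C_mul, coeff_X_pow_mul', if_pos hk',
    rowSeries, coeff_mk, Nat.cast_sub hk']
  push_cast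
  ring_nf

lemma det_relation {n : ℕ} {m : ℂ} {c : ℕ → ℂ} (hm : m.im ≠ 0)
    (hc : ∀ k < n, c (k + 1) * indicial (n : ℂ) m ((k : ℂ) + 1) = c k * nextSymbol (n : ℂ) m k) :
    (-1) ^ n * c n * bdet m (2 * n + 1) 0 1 =
      (∑ k ∈ Finset.range (n + 1),
        c k * ((-1) ^ k * gbinom (m + 2 * n - 1 + k) (2 * n + 1 - k))) * bdet m (2 * n) 0 1 := by
  rw [← coeff_symPoly, ← coeff_rotated_last]
  refine last_mul_det_of_vecMul_eq_single _
    (fun i : Fin (2 * n + 1) => (symPoly c n).coeff i) _ ?_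
  funext j
  have hsum : Matrix.vecMul (fun i : Fin (2 * n + 1) => (symPoly c n).coeff i)
      (Matrix.of fun i j : Fin (2 * n + 1) => (if 0 + i.1 = 1 + j.1 then (-1 : ℂ) else 0)
        + gbinom (m + ((0 + i.1 : ℕ) : ℂ) + ((1 + j.1 : ℕ) : ℂ) - 2) (1 + j.1)) j
      = coeff (1 + j.1) (∑ k ∈ Finset.range (n + 1),
          C (c k) * (rowSeries m 0 * (geomSeries * (1 - geomSeries)) ^ k))
        - (symPoly c n).coeff (1 + j.1) := by
    rw [← sum_coeff_symPoly_rowSeries, map_sum]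
    simp only [Matrix.vecMul, dotProduct, Matrix.of_apply, zero_add]
    rw [Fin.sum_univ_eq_sum_range (fun i => (symPoly c n).coeff i *
      ((if i = 1 + j.1 then (-1 : ℂ) else 0)
        + gbinom (m + (i : ℂ) + ((1 + j.1 : ℕ) : ℂ) - 2) (1 + j.1))) (2 * n + 1)]
    simp only [mul_add, Finset.sum_add_distrib, mul_ite, mul_zero, Finset.sum_ite_eq',
      coeff_C_mul, rowSeries, coeff_mk, Finset.mem_range]
    have h0 : ¬ 1 + j.1 < 2 * n + 1 → (symPoly c n).coeff (1 + j.1) = 0 := fun h =>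
      Polynomial.coeff_eq_zero_of_natDegree_lt (by have := natDegree_symPoly_le c n; omega)
    split_ifs with h
    · ring
    · rw [h0 h]; ring
  rw [hsum]
  rcases Fin.eq_castSucc_or_eq_last j with ⟨j, rfl⟩ | rfl
  · rw [Pi.single_eq_of_ne (Fin.castSucc_lt_last j).ne, Fin.val_castSucc,
      coeff_rotated_eq hm hc (by omega), ← coe_symPoly, Polynomial.coeff_coe, sub_self]
  · rw [Pi.single_eq_same, Fin.val_last, add_comm 1,
      Polynomial.coeff_eq_zero_of_natDegree_lt (n := 2 * n + 1)
        (by have := natDegree_symPoly_le c n; omega), sub_zero]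

end Determinant

section Summation

lemma prod_range_erase_sub (k l : ℕ) :
    ∏ j ∈ (Finset.range (k + l + 1)).erase k, ((k : ℂ) - j)
      = (-1) ^ l * (k.factorial * l.factorial) := by
  induction l with
  | zero =>
    rw [add_zero, Finset.range_add_one, Finset.erase_insert Finset.notMem_range_self]
    have h : ∏ j ∈ Finset.range k, ((k : ℂ) - j) = ∏ j ∈ Finset.range k, ((j + 1 : ℕ) : ℂ) := by
      rw [← Finset.prod_range_reflect]
      refine Finset.prod_congr rfl fun j hj => ?_
      have := Finset.mem_range.1 hj
      rw [show k - 1 - j = k - (j + 1) by omega, Nat.cast_sub (by omega)]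
      ring
    rw [h, ← Nat.cast_prod, Finset.prod_range_add_one_eq_factorial]
    simp
  | succ l ih =>
    rw [← add_assoc, Finset.range_add_one, Finset.erase_insert_of_ne (by omega),
      Finset.prod_insert (by simp), ih, Nat.factorial_succ]
    push_cast
    ring

/-- Partial fraction expansion with poles at `0, …, n`. -/
lemma sum_choose_mul_eval_div (n : ℕ) (Q : Polynomial ℂ) (hQ : Q.degree < (n + 1 : ℕ)) (x : ℂ)
    (hx : ∀ k ∈ Finset.range (n + 1), x ≠ (k : ℂ)) :
    (∏ k ∈ Finset.range (n + 1), (x - k)) * ∑ k ∈ Finset.range (n + 1),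
      (-1) ^ k * (n.choose k : ℂ) * Q.eval (k : ℂ) / (x - k)
      = (-1) ^ n * n.factorial * Q.eval x := by
  have hinj : Set.InjOn (fun k : ℕ => (k : ℂ)) (Finset.range (n + 1) : Finset ℕ) :=
    Nat.cast_injective.injOn
  have h := Lagrange.eval_interpolate_not_at_node (s := Finset.range (n + 1))
    (v := fun k : ℕ => (k : ℂ)) (fun k => Q.eval (k : ℂ)) hx
  rw [← Lagrange.eq_interpolate hinj (by simpa using hQ), Lagrange.eval_nodal] at h
  rw [h, mul_left_comm]
  congr 1
  rw [Finset.mul_sum]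
  refine Finset.sum_congr rfl fun k hk => ?_
  obtain ⟨l, rfl⟩ := Nat.exists_eq_add_of_le (Nat.lt_succ_iff.1 (Finset.mem_range.1 hk))
  have hw : Lagrange.nodalWeight (Finset.range (k + l + 1)) (fun k : ℕ => (k : ℂ)) k
      = ((-1 : ℂ) ^ l * (k.factorial * l.factorial))⁻¹ := by
    rw [Lagrange.nodalWeight, Finset.prod_inv_distrib, prod_range_erase_sub]
  have hch : ((k + l).choose k : ℂ) * k.factorial * l.factorial = (k + l).factorial := by
    have := Nat.choose_mul_factorial_mul_factorial (Nat.le_add_right k l)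
    rw [Nat.add_sub_cancel_left] at this
    exact_mod_cast this
  have h1 : (k.factorial : ℂ) ≠ 0 := by exact_mod_cast k.factorial_ne_zero
  have h2 : (l.factorial : ℂ) ≠ 0 := by exact_mod_cast l.factorial_ne_zero
  have h3 : x - (k : ℂ) ≠ 0 := sub_ne_zero.2 (hx k hk)
  rw [hw, ← hch, pow_add]
  field_simp

lemma poch_succ (x : ℂ) (k : ℕ) : poch x (k + 1) = poch x k * (x + k) :=
  Finset.prod_range_succ _ _

lemma poch_succ' (x : ℂ) (k : ℕ) : poch x (k + 1) = x * poch (x + 1) k := by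
  rw [poch, poch, Finset.prod_range_succ', mul_comm]
  congr 1
  · simp
  · exact Finset.prod_congr rfl fun i _ => by push_cast; ring

lemma poch_natCast_reflect (n : ℕ) :
    ∏ k ∈ Finset.range (n + 1), ((2 * n + 1 : ℂ) - k) = poch ((n : ℂ) + 1) (n + 1) := by
  rw [poch, ← Finset.prod_range_reflect]
  refine Finset.prod_congr rfl fun k hk => ?_
  have := Finset.mem_range.1 hk
  rw [show n + 1 - 1 - k = n - k by omega, Nat.cast_sub (by omega)]
  ring

lemma sum_choose_mul_poch_div (n : ℕ) (a : ℂ) :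
    poch ((n : ℂ) + 1) (n + 1) * ∑ k ∈ Finset.range (n + 1),
      (-1) ^ k * (n.choose k : ℂ) * poch (a + k) n / (2 * n + 1 - k)
      = (-1) ^ n * n.factorial * poch (a + 2 * n + 1) n := by
  set Q : Polynomial ℂ :=
    ∏ i ∈ Finset.range n, (Polynomial.X + Polynomial.C (a + i)) with hQdef
  have hQ : ∀ x, Q.eval x = poch (a + x) n := fun x => by
    rw [hQdef, Polynomial.eval_prod, poch]
    exact Finset.prod_congr rfl fun i _ => by simp; ring
  have hdeg : Q.degree < (n + 1 : ℕ) := by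
    rw [hQdef, Polynomial.degree_prod]
    simp only [Polynomial.degree_X_add_C, Finset.sum_const, Finset.card_range]
    simp only [nsmul_eq_mul, mul_one]
    exact_mod_cast Nat.lt_succ_self n
  have h := sum_choose_mul_eval_div n Q hdeg (2 * n + 1) fun k hk h => by
    have := Finset.mem_range.1 hk
    have : (2 * n + 1 : ℕ) = k := by exact_mod_cast h
    omega
  simpa only [hQ, poch_natCast_reflect, ← add_assoc] using h

lemma gbinom_mul_factorial (x : ℂ) (k : ℕ) :
    gbinom x k * k.factorial = poch (x - k + 1) k := by
  have h : (k.factorial : ℂ) ≠ 0 := by exact_mod_cast k.factorial_ne_zero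
  rw [gbinom, div_mul_cancel₀ _ h, poch, ← Finset.prod_range_reflect]
  refine Finset.prod_congr rfl fun i hi => ?_
  have := Finset.mem_range.1 hi
  rw [show k - 1 - i = k - (i + 1) by omega, Nat.cast_sub (by omega)]
  push_cast
  ring

lemma gbinom_shift (x : ℂ) (k : ℕ) :
    gbinom (x + 1) k * ((x - k + 1) * (x - k)) = (x + 1) * (k + 1) * gbinom x (k + 1) := by
  have h1 := succ_mul_gbinom_succ x k
  have h2 := succ_mul_gbinom_succ (x + 1) k
  have h3 := succ_mul_gbinom_succ_succ x k
  linear_combination (x - k) * (h3 - h2) - (x + 1) * h1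

lemma poch_shift (a : ℂ) (n : ℕ) : a * poch (a + 1) n = poch a n * (a + n) := by
  rw [← poch_succ, poch_succ']

lemma mul_gbinom_eq {n : ℕ} {m : ℂ} {c : ℕ → ℂ} (hm : m.im ≠ 0)
    (hc : ∀ k < n, c (k + 1) * indicial (n : ℂ) m ((k : ℂ) + 1) = c k * nextSymbol (n : ℂ) m k) :
    ∀ k ≤ n, c k * gbinom (m + 2 * n - 1 + k) (2 * n + 1 - k) * poch (m / 2) n * (2 * n + 1 - k)
      = c 0 * gbinom (m + 2 * n - 1) (2 * n + 1) * (2 * n + 1) * n.choose k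
        * poch (m / 2 + k) n := by
  intro k
  induction k with
  | zero => intro _; simp; ring
  | succ k ih =>
    intro hk
    have ih := ih (by omega)
    have hck := hc k (by omega)
    have hch : (n.choose (k + 1) : ℂ) * (k + 1) = n.choose k * (n - k) := by
      rw [← Nat.cast_sub (by omega : k ≤ n)]
      exact_mod_cast Nat.choose_succ_right_eq n k
    have hg := gbinom_shift (m + 2 * n - 1 + k) (2 * n - k)
    rw [Nat.cast_sub (by omega : k ≤ 2 * n), show 2 * n - k + 1 = 2 * n + 1 - k by omega] at hg
    have hp := poch_shift (m / 2 + k) n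
    have hi := indicial_ne_zero (n := n) (j := k + 1) hm (by omega) (by omega)
    have ha : m + 2 * k ≠ 0 := fun h => hm (by simpa using congrArg Complex.im h)
    have hb : m + 2 * k - 1 ≠ 0 := fun h => hm (by simpa using congrArg Complex.im h)
    rw [show 2 * n + 1 - (k + 1) = 2 * n - k by omega]
    push_cast at hi hg ⊢
    rw [← add_assoc, ← add_assoc]
    apply mul_left_cancel₀ (mul_ne_zero (mul_ne_zero hi ha) hb)
    rw [indicial, nextSymbol] at hck
    rw [indicial]
    linear_combination
      gbinom (m + 2 * n - 1 + k + 1) (2 * n - k) * (m + 2 * k) * (m + 2 * k - 1)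
        * poch (m / 2) n * (2 * n - k) * hck
      + c k * ((k - n) * (2 * k + m - 1) * (2 * k + 2 * n + m)) * poch (m / 2) n * (2 * n - k) * hg
      + (k - n) * (2 * k + m - 1) * (2 * k + 2 * n + m) * (m + 2 * n + k) * (2 * n - k) * ih
      - c 0 * gbinom (m + 2 * n - 1) (2 * n + 1) * (2 * n + 1) * (m + 2 * k - 1) * (k - 2 * n)
        * (k + 2 * n + m) * ((m + 2 * k) * poch (m / 2 + k + 1) n * hch
          + n.choose k * (n - k) * 2 * hp)

end Summation

section Quotient

lemma exists_symbol_recurrence {n : ℕ} {m : ℂ} (hm : m.im ≠ 0) :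
    ∃ c : ℕ → ℂ, c 0 = 1 ∧ ∀ k < n,
      c (k + 1) * indicial (n : ℂ) m ((k : ℂ) + 1) = c k * nextSymbol (n : ℂ) m k := by
  refine ⟨fun k => Nat.rec 1
    (fun k a => a * nextSymbol (n : ℂ) m k / indicial (n : ℂ) m ((k : ℂ) + 1)) k, rfl, ?_⟩
  intro k hk
  have hi := indicial_ne_zero (n := n) (j := k + 1) hm (by omega) (by omega)
  rw [Nat.cast_succ] at hi
  exact div_mul_cancel₀ _ hi

lemma poch_add_two (n : ℕ) :
    poch ((n : ℂ) + 2) (n + 1) = 2 * poch ((n : ℂ) + 1) (n + 1) := by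
  have h : (n : ℂ) + 1 ≠ 0 := by exact_mod_cast n.succ_ne_zero
  apply mul_left_cancel₀ h
  have h' := poch_shift ((n : ℂ) + 1) (n + 1)
  rw [add_assoc, one_add_one_eq_two] at h'
  push_cast at h'
  linear_combination h'

lemma quotient_of_im_ne_zero {m : ℂ} (hm : m.im ≠ 0) (n : ℕ) :
    bdet m (2 * n + 1) 0 1 * poch ((n : ℂ) + 2) (n + 1) * poch (m / 2 + n) (n + 1)
      = 2 * poch (m / 2 + 2 * n) (n + 1) * poch (m + 2 * n - 1) (n + 1)
        * bdet m (2 * n) 0 1 := by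
  obtain ⟨c, hc0, hc⟩ := exists_symbol_recurrence (n := n) hm
  have hdet := det_relation hm hc
  have hterm := mul_gbinom_eq hm hc
  rw [hc0] at hterm
  set g := gbinom (m + 2 * n - 1) (2 * n + 1)
  have hlast := hterm n le_rfl
  have hfac := gbinom_mul_factorial (m + 2 * n - 1 + n) (n + 1)
  rw [show 2 * n + 1 - n = n + 1 by omega, Nat.choose_self] at hlast
  rw [Nat.factorial_succ] at hfac
  push_cast at hlast hfac
  rw [show m + 2 * n - 1 + n - (n + 1) + 1 = m + 2 * n - 1 by ring] at hfac
  have hsum : (∑ k ∈ Finset.range (n + 1),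
      c k * ((-1) ^ k * gbinom (m + 2 * n - 1 + k) (2 * n + 1 - k))) * poch (m / 2) n
      = g * (2 * n + 1) * ∑ k ∈ Finset.range (n + 1),
        (-1) ^ k * (n.choose k : ℂ) * poch (m / 2 + k) n / (2 * n + 1 - k) := by
    rw [Finset.sum_mul, Finset.mul_sum]
    refine Finset.sum_congr rfl fun k hk => ?_
    have hk := Finset.mem_range.1 hk
    have hne : (2 * n + 1 - k : ℂ) ≠ 0 := fun h => by
      have : (2 * n + 1 : ℕ) = k := by exact_mod_cast sub_eq_zero.1 h
      omega
    rw [mul_div_assoc', eq_div_iff hne]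
    linear_combination (-1) ^ k * hterm k (by omega)
  have hfrac := sum_choose_mul_poch_div n (m / 2)
  have hg0 : g * (2 * n + 1) ≠ 0 := by
    refine mul_ne_zero (div_ne_zero (Finset.prod_ne_zero_iff.2 fun i _ h => hm ?_) ?_) ?_
    · simpa using congrArg Complex.im h
    · exact_mod_cast Nat.factorial_ne_zero (2 * n + 1)
    · exact_mod_cast Nat.succ_ne_zero (2 * n)
  have hsq : ((-1 : ℂ) ^ n) ^ 2 = 1 := by rw [← pow_mul, mul_comm, pow_mul]; simp
  set G := gbinom (m + 2 * n - 1 + n) (n + 1)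
  have key : bdet m (2 * n + 1) 0 1 * poch (m / 2 + n) n * poch ((n : ℂ) + 1) (n + 1)
      = poch (m / 2 + 2 * n + 1) n * poch (m + 2 * n - 1) (n + 1) * bdet m (2 * n) 0 1 := by
    apply mul_left_cancel₀ hg0
    set b := bdet m (2 * n + 1) 0 1
    set b' := bdet m (2 * n) 0 1
    set P := poch (m / 2) n
    set W := poch ((n : ℂ) + 1) (n + 1)
    linear_combination (-(b * W)) * hlast + (-1) ^ n * G * P * W * (n + 1) * hdet
      - c n * b * G * P * W * (n + 1) * hsq
      + (-1) ^ n * G * W * (n + 1) * b' * hsum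
      + (-1) ^ n * G * (n + 1) * b' * g * (2 * n + 1) * hfrac
      + G * (n + 1) * b' * g * (2 * n + 1) * n.factorial * poch (m / 2 + 2 * n + 1) n * hsq
      + g * (2 * n + 1) * poch (m / 2 + 2 * n + 1) n * b' * hfac
  rw [poch_add_two, poch_succ (m / 2 + n) n, poch_succ' (m / 2 + 2 * n) n]
  linear_combination 2 * (m / 2 + 2 * n) * key

lemma continuous_poch {f : ℂ → ℂ} (hf : Continuous f) (k : ℕ) :
    Continuous fun m => poch (f m) k := by
  unfold poch
  fun_prop

lemma continuous_gbinom {f : ℂ → ℂ} (hf : Continuous f) (k : ℕ) :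
    Continuous fun m => gbinom (f m) k := by
  unfold gbinom
  fun_prop

lemma continuous_bdet (n I J : ℕ) : Continuous fun m => bdet m n I J := by
  refine Continuous.matrix_det (continuous_matrix fun i j => ?_)
  exact continuous_const.add (continuous_gbinom (by fun_prop) _)

lemma dense_im_ne_zero : Dense {m : ℂ | m.im ≠ 0} := by
  have h := (dense_compl_singleton (0 : ℝ)).preimage Complex.isOpenMap_im
  exact h

end Quotient

/-- The quotient `Q1(n) = b_{2n+1}(0,1)/b_{2n}(0,1)` (cleared form). -/
theorem quotient_Q1 (μ : ℂ) (n : ℕ) (hn : 1 ≤ n) :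
    bdet μ (2 * n + 1) 0 1 * poch ((n : ℂ) + 2) (n + 1) * poch (μ / 2 + n) (n + 1)
      = 2 * poch (μ / 2 + 2 * n) (n + 1) * poch (μ + 2 * n - 1) (n + 1)
        * bdet μ (2 * n) 0 1 := by
  have h := Continuous.ext_on dense_im_ne_zero
    (f := fun m => bdet m (2 * n + 1) 0 1 * poch ((n : ℂ) + 2) (n + 1) * poch (m / 2 + n) (n + 1))
    (g := fun m => 2 * poch (m / 2 + 2 * n) (n + 1) * poch (m + 2 * n - 1) (n + 1)
      * bdet m (2 * n) 0 1)
    (((continuous_bdet _ _ _).mul continuous_const).mul (continuous_poch (by fun_prop) _))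
    (((continuous_const.mul (continuous_poch (by fun_prop) _)).mul
      (continuous_poch (by fun_prop) _)).mul (continuous_bdet _ _ _))
    fun m hm => quotient_of_im_ne_zero hm n
  exact congrFun h μ
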